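/- Let P be a submonoid of a group G and let C*_λ(P) denote the operator-norm closure of the unital star-subalgebra of bounded operators on ℓ²(P) generated by {V_p : p ∈ P}. Let A be a nontrivial unital C*-algebra and let Φ : C*_λ(P) → A be a unital star-algebra homomorphism such that Φ(V_p) is a unitary element of A for every p ∈ P. Then pP ∩ qP ≠ ∅ for all p, q ∈ P, i.e., P is left reversible. -/

import Mathlib

noncomputable section

open ContinuousLinearMap
open scoped Classical

variable {G : Type*} [Group G]

/-- The Hilbert space ℓ²(P). -/
abbrev l2 (P : Submonoid G) : Type _ := lp (fun _ : P => ℂ) 2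

/-- The standard orthonormal basis vector δ_s of ℓ²(P). -/
def delta (P : Submonoid G) (s : P) : l2 P :=
  letI := Classical.decEq P
  lp.single 2 s 1

/-- The set pX = {px : x ∈ X}. -/
def lmul (P : Submonoid G) (p : P) (X : Set P) : Set P := (fun x => p * x) '' X

/-- The set p⁻¹X = {y ∈ P : py ∈ X}. -/
def linv (P : Submonoid G) (p : P) (X : Set P) : Set P := {y : P | p * y ∈ X}

/-- The set p₁⁻¹q₁ ⋯ pₙ⁻¹qₙ X, the operations being applied iteratively from the right;
the word is encoded as the list [(p₁,q₁),…,(pₙ,qₙ)]. -/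
def wordSet (P : Submonoid G) (l : List (P × P)) (X : Set P) : Set P :=
  l.foldr (fun a Y => linv P a.1 (lmul P a.2 Y)) X

/-- The operator V_{p₁}* V_{q₁} ⋯ V_{pₙ}* V_{qₙ} on ℓ²(P), the word being encoded as the
list [(p₁,q₁),…,(pₙ,qₙ)]. -/
def opWord (P : Submonoid G) (V : P → (l2 P →L[ℂ] l2 P)) (l : List (P × P)) :
    l2 P →L[ℂ] l2 P :=
  (l.map fun a => (ContinuousLinearMap.adjoint (V a.1)) * (V a.2)).prod

/-- The group element p₁⁻¹q₁ ⋯ pₙ⁻¹qₙ of G. -/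
def grpWord (P : Submonoid G) (l : List (P × P)) : G :=
  (l.map fun a => ((a.1 : G))⁻¹ * (a.2 : G)).prod


/-- The standard basis vectors of ℓ²(P) have dense span: a bounded operator is determined by
its values on them. -/
theorem clm_ext_delta (P : Submonoid G) {S T : l2 P →L[ℂ] l2 P}
    (h : ∀ s, S (delta P s) = T (delta P s)) : S = T := by
  refine lp.ext_continuousLinearMap (by norm_num) fun s => ?_
  ext1
  simp only [coe_comp, Function.comp_apply, lp.singleContinuousLinearMap_apply]
  convert h s using 2 <;>
    exact congrArg (fun d => @lp.single P (fun _ => ℂ) _ d 2 s 1) (Subsingleton.elim _ _)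

theorem inner_delta_left (P : Submonoid G) (s : P) (f : l2 P) :
    inner ℂ (delta P s) f = f s := by
  simp [delta, lp.inner_single_left]

theorem adjoint_mul_eq_zero_of_disjoint (P : Submonoid G)
    (V : P → (l2 P →L[ℂ] l2 P))
    (hV : ∀ p s : P, V p (delta P s) = delta P (p * s)) {p q : P}
    (hpq : ¬ (lmul P p Set.univ ∩ lmul P q Set.univ).Nonempty) :
    star (V p) * V q = 0 := by
  refine clm_ext_delta P fun t => lp.ext (funext fun s => ?_)
  have hne : p * s ≠ q * t := fun h =>
    hpq ⟨p * s, ⟨s, trivial, rfl⟩, ⟨t, trivial, h.symm⟩⟩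
  rw [← inner_delta_left, star_eq_adjoint, mul_apply_eq_comp, adjoint_inner_right,
    hV, hV, inner_delta_left]
  simp [delta, hne]

/-- If C*_λ(P), the norm closure of the unital *-subalgebra of B(ℓ²(P)) generated by
{V_p : p ∈ P}, admits a unital *-homomorphism into a nontrivial unital C*-algebra sending
each V_p to a unitary, then pP ∩ qP ≠ ∅ for all p, q ∈ P, i.e. P is left reversible. -/
theorem stmt13 (P : Submonoid G)
    (V : P → (l2 P →L[ℂ] l2 P))
    (hV : ∀ p s : P, V p (delta P s) = delta P (p * s))
    {A : Type*} [NormedRing A] [StarRing A] [CStarRing A] [NormedAlgebra ℂ A]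
    [StarModule ℂ A] [CompleteSpace A] [Nontrivial A]
    (Φ : ↥((StarAlgebra.adjoin ℂ (Set.range V)).topologicalClosure) →⋆ₐ[ℂ] A)
    (hΦ : ∀ (p : P) (hp : V p ∈ (StarAlgebra.adjoin ℂ (Set.range V)).topologicalClosure),
        Φ ⟨V p, hp⟩ ∈ unitary A)
    (p q : P) :
    (lmul P p Set.univ ∩ lmul P q Set.univ).Nonempty := by
  by_contra hpq
  have hmem (r : P) : V r ∈ (StarAlgebra.adjoin ℂ (Set.range V)).topologicalClosure :=
    StarSubalgebra.le_topologicalClosure _ (StarAlgebra.subset_adjoin ℂ _ ⟨r, rfl⟩)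
  have hzero : star (⟨V p, hmem p⟩ : (StarAlgebra.adjoin ℂ (Set.range V)).topologicalClosure) *
      ⟨V q, hmem q⟩ = 0 :=
    Subtype.ext (adjoint_mul_eq_zero_of_disjoint P V hV hpq)
  have hΦzero : star (Φ ⟨V p, hmem p⟩) * Φ ⟨V q, hmem q⟩ = 0 := by
    rw [← map_star, ← map_mul, hzero, map_zero]
  have hΦq : Φ ⟨V q, hmem q⟩ = 0 := by
    rw [← one_mul (Φ ⟨V q, hmem q⟩), ← Unitary.mul_star_self_of_mem (hΦ p (hmem p)), mul_assoc,
      hΦzero, mul_zero]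
  have hone := Unitary.star_mul_self_of_mem (hΦ q (hmem q))
  rw [hΦq, mul_zero] at hone
  exact zero_ne_one hone
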